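/- There exists a constant c > 0 with the following property. Let 0 < α, γ < 1, let β* ∈ ℝ^d, let Σ ∈ ℝ^{d×d} be positive definite, and let β_1, …, β_m be an i.i.d. sample S from the multivariate normal distribution N(β*, Σ) with m ≥ c·(d + log(1/γ))/α². Then with probability at least 1 − γ over the sample, every point β̂ ∈ ℝ^d whose Tukey depth with respect to S is at least p, where p satisfies 0 < 1 − p/m + α < 1, obeys ‖β̂ − β*‖_Σ ≤ Φ⁻¹(1 − p/m + α). -/

import Mathlib

open MeasureTheory ProbabilityTheory Matrix
open scoped ENNReal NNReal

/-- The exact Tukey depth of `y` with respect to the finite multiset `D` of points in `ℝ^d`: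
the minimum, over nonzero directions `v`, of the number of points of `D` (with multiplicity)
in the halfspace `{x | ⟨v, x⟩ ≥ ⟨v, y⟩}`. -/
noncomputable def tukeyDepth {d : ℕ} (D : Multiset (Fin d → ℝ)) (y : Fin d → ℝ) : ℕ :=
  sInf {n : ℕ | ∃ v : Fin d → ℝ, v ≠ 0 ∧
    n = Multiset.countP (fun x => ∑ j, v j * y j ≤ ∑ j, v j * x j) D}

/-- The Mahalanobis norm `‖z‖_Σ = sqrt(⟨z, Sig⁻¹ z⟩)` associated to a matrix `Σ`. -/
noncomputable def mahalanobisNorm {d : ℕ} (Sig : Matrix (Fin d) (Fin d) ℝ)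
    (z : Fin d → ℝ) : ℝ :=
  Real.sqrt (z ⬝ᵥ (Sig⁻¹ *ᵥ z))

/-- `Φ`, the cumulative distribution function of the standard univariate Gaussian. -/
noncomputable def stdGaussianCDF : ℝ → ℝ := fun x => cdf (gaussianReal 0 1) x

/-- `Φ⁻¹`, the inverse of the standard Gaussian CDF (on `(0,1)`). -/
noncomputable def stdGaussianCDFInv : ℝ → ℝ := Function.invFun stdGaussianCDF

/-- A measure `μ` on `ℝ^d` is the multivariate Gaussian `N(β*, Σ)` iff every
one-dimensional linear marginal `⟨v, ·⟩` is the univariate Gaussian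
`N(⟨v, β*⟩, vᵀ Σ v)`. -/
def IsMultivariateGaussian {d : ℕ} (μ : Measure (Fin d → ℝ)) (βstar : Fin d → ℝ)
    (Sig : Matrix (Fin d) (Fin d) ℝ) : Prop :=
  ∀ v : Fin d → ℝ,
    μ.map (fun y => ∑ j, v j * y j)
      = gaussianReal (∑ j, v j * βstar j) (Real.toNNReal (v ⬝ᵥ (Sig *ᵥ v)))


lemma td_integrable_bdd {X : Type*} [MeasurableSpace X] {μ : Measure X} [IsFiniteMeasure μ]
    {f : X → ℝ} (hf : Measurable f) (C : ℝ) (hC : ∀ x, |f x| ≤ C) : Integrable f μ :=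
  Integrable.of_bound hf.aestronglyMeasurable C (Filter.Eventually.of_forall hC)

lemma td_mgf {X : Type*} [MeasurableSpace X] (μ : Measure X) [IsProbabilityMeasure μ]
    (g : X → ℝ) (hg : Measurable g) (hb : ∀ x, |g x| ≤ 1) (l : ℝ) (h0 : 0 ≤ l) (h1 : l ≤ 1) :
    ∫ x, Real.exp (l * g x - l * ∫ y, g y ∂μ - l ^ 2 * ∫ y, g y ^ 2 ∂μ) ∂μ ≤ 1 := by
  set p := ∫ y, g y ∂μ
  set q := ∫ y, g y ^ 2 ∂μ
  have e1 : ∀ x, Real.exp (l * g x - l * p - l ^ 2 * q)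
      = Real.exp (l * g x) * Real.exp (-(l * p + l ^ 2 * q)) := by
    intro x; rw [← Real.exp_add]; congr 1; ring
  simp_rw [e1]
  rw [integral_mul_const]
  have hlg : ∀ x, |l * g x| ≤ 1 := fun x => by
    rw [abs_mul, abs_of_nonneg h0]
    have := hb x; have := abs_nonneg (g x); nlinarith
  have i1 : Integrable g μ := td_integrable_bdd hg 1 hb
  have i2 : Integrable (fun x => g x ^ 2) μ := td_integrable_bdd (hg.pow_const 2) 1 fun x => by
    rw [abs_pow]; exact pow_le_one₀ (abs_nonneg _) (hb x)
  have e2 : ∫ x, Real.exp (l * g x) ∂μ ≤ ∫ x, (1 + l * g x + l ^ 2 * g x ^ 2) ∂μ := by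
    apply integral_mono
    · apply td_integrable_bdd (by fun_prop) (Real.exp 1)
      intro x
      rw [Real.abs_exp]
      exact Real.exp_le_exp.2 (le_of_abs_le (hlg x))
    · exact ((integrable_const _).add (i1.const_mul l)).add (i2.const_mul (l ^ 2))
    · intro x
      have := le_of_abs_le (Real.abs_exp_sub_one_sub_id_le (hlg x))
      dsimp only
      nlinarith
  have e3 : ∫ x, (1 + l * g x + l ^ 2 * g x ^ 2) ∂μ = 1 + l * p + l ^ 2 * q := by
    have i12 : Integrable (fun x => 1 + l * g x) μ := (integrable_const _).add (i1.const_mul l)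
    rw [integral_add i12 (i2.const_mul (l ^ 2)),
      integral_add (integrable_const _) (i1.const_mul l), integral_const_mul, integral_const_mul]
    simp [p, q]
  have e4 : 1 + l * p + l ^ 2 * q ≤ Real.exp (l * p + l ^ 2 * q) := by
    have := Real.add_one_le_exp (l * p + l ^ 2 * q); linarith
  calc _ ≤ Real.exp (l * p + l ^ 2 * q) * Real.exp (-(l * p + l ^ 2 * q)) := by
        gcongr; linarith
    _ = 1 := by rw [← Real.exp_add]; simp

/-- exponent -/
noncomputable def tdExpo {X Ξ : Type*} [MeasurableSpace X] (μ : Measure X) {m : ℕ}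
    (g : Ξ → X → ℝ) (l : ℝ) (ξ : Ξ) (B : Fin m → X) : ℝ :=
  ∑ i, (l * g ξ (B i) - l * ∫ y, g ξ y ∂μ - l ^ 2 * ∫ y, g ξ y ^ 2 ∂μ)

lemma td_meas_int {X Ξ : Type*} [MeasurableSpace X] [MeasurableSpace Ξ] (μ : Measure X)
    [IsProbabilityMeasure μ]
    (g : Ξ → X → ℝ) (hg : Measurable (Function.uncurry g)) :
    Measurable (fun ξ => ∫ y, g ξ y ∂μ) :=
  (hg.stronglyMeasurable.integral_prod_right).measurable

lemma td_expo_meas {X Ξ : Type*} [MeasurableSpace X] [MeasurableSpace Ξ] (μ : Measure X)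
    [IsProbabilityMeasure μ] {m : ℕ}
    (g : Ξ → X → ℝ) (hg : Measurable (Function.uncurry g)) (l : ℝ) :
    Measurable (fun z : Ξ × (Fin m → X) => tdExpo μ g l z.1 z.2) := by
  have a1 := td_meas_int μ g hg
  have a2 := td_meas_int μ (fun ξ x => g ξ x ^ 2) (hg.pow_const 2)
  unfold tdExpo
  refine Finset.measurable_sum _ fun i _ => ?_
  have a3 : Measurable (fun z : Ξ × (Fin m → X) => g z.1 (z.2 i)) :=
    hg.comp (f := fun z : Ξ × (Fin m → X) => (z.1, z.2 i)) (by fun_prop)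
  exact ((a3.const_mul l).sub ((a1.comp measurable_fst).const_mul l)).sub
    ((a2.comp measurable_fst).const_mul (l ^ 2))

lemma td_expo_bdd {X Ξ : Type*} [MeasurableSpace X] (μ : Measure X)
    [IsProbabilityMeasure μ] {m : ℕ}
    (g : Ξ → X → ℝ) (hb : ∀ ξ x, |g ξ x| ≤ 1) (l : ℝ) (h0 : 0 ≤ l) (h1 : l ≤ 1)
    (ξ : Ξ) (B : Fin m → X) : |tdExpo μ g l ξ B| ≤ m * 3 := by
  unfold tdExpo
  refine (Finset.abs_sum_le_sum_abs _ _).trans ?_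
  refine (Finset.sum_le_card_nsmul _ _ 3 fun i _ => ?_).trans (by simp)
  have b1 : |∫ y, g ξ y ∂μ| ≤ 1 := by
    have := norm_integral_le_of_norm_le_const (μ := μ) (f := g ξ) (C := 1)
      (Filter.Eventually.of_forall (hb ξ))
    simpa using this
  have b2 : |∫ y, g ξ y ^ 2 ∂μ| ≤ 1 := by
    have := norm_integral_le_of_norm_le_const (μ := μ) (f := fun y => g ξ y ^ 2) (C := 1)
      (Filter.Eventually.of_forall fun y => by
        rw [Real.norm_eq_abs, abs_pow]; exact pow_le_one₀ (abs_nonneg _) (hb ξ y))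
    simpa using this
  have key : ∀ a b : ℝ, 0 ≤ a → a ≤ 1 → |b| ≤ 1 → |a * b| ≤ 1 := fun a b ha ha1 hb' => by
    rw [abs_mul, abs_of_nonneg ha]; have := abs_nonneg b; nlinarith
  have c1 := key l _ h0 h1 (hb ξ (B i))
  have c2 := key l _ h0 h1 b1
  have c3 := key (l ^ 2) _ (by positivity) (pow_le_one₀ h0 h1) b2
  rw [abs_le] at *
  constructor <;> linarith [c1.1, c1.2, c2.1, c2.2, c3.1, c3.2]

lemma td_pb {X Ξ : Type*} [MeasurableSpace X] [MeasurableSpace Ξ] (μ : Measure X)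
    [IsProbabilityMeasure μ] {m : ℕ} (Q : Measure Ξ) [IsProbabilityMeasure Q]
    (g : Ξ → X → ℝ) (hg : Measurable (Function.uncurry g)) (hb : ∀ ξ x, |g ξ x| ≤ 1)
    (l : ℝ) (h0 : 0 ≤ l) (h1 : l ≤ 1) :
    ∫⁻ B, ∫⁻ ξ, ENNReal.ofReal (Real.exp (tdExpo μ g l ξ B)) ∂Q
      ∂(Measure.pi fun _ : Fin m => μ) ≤ 1 := by
  have hm := td_expo_meas (m := m) μ g hg l
  rw [lintegral_lintegral_swap]
  · calc _ ≤ ∫⁻ ξ, 1 ∂Q := by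
          apply lintegral_mono
          intro ξ
          dsimp only
          rw [← ofReal_integral_eq_lintegral_ofReal]
          · rw [← ENNReal.ofReal_one]
            apply ENNReal.ofReal_le_ofReal
            simp only [tdExpo, Real.exp_sum]
            rw [integral_fintype_prod_eq_prod (μ := fun _ : Fin m => μ) (fun _ x => Real.exp (l * g ξ x - l * ∫ y, g ξ y ∂μ - l ^ 2 * ∫ y, g ξ y ^ 2 ∂μ))]
            apply Finset.prod_le_one
            · intro i _; positivity
            · intro i _
              exact td_mgf μ (g ξ) (hg.comp (measurable_const.prodMk measurable_id)) (hb ξ) l h0 h1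
          · apply td_integrable_bdd _ (Real.exp (m * 3))
            · intro B
              rw [Real.abs_exp]
              exact Real.exp_le_exp.2 (le_of_abs_le (td_expo_bdd μ g hb l h0 h1 ξ B))
            · exact (hm.comp (measurable_const.prodMk measurable_id)).exp
          · exact Filter.Eventually.of_forall fun _ => (Real.exp_pos _).le
      _ = 1 := by simp
  · exact (hm.comp measurable_swap).exp.ennreal_ofReal.aemeasurable

lemma td_dev {X Ξ : Type*} [MeasurableSpace X] [MeasurableSpace Ξ] (μ : Measure X)
    [IsProbabilityMeasure μ] {m : ℕ} (Q ρ : Measure Ξ) [IsProbabilityMeasure ρ]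
    (g : Ξ → X → ℝ) (hg : Measurable (Function.uncurry g)) (hb : ∀ ξ x, |g ξ x| ≤ 1)
    (l : ℝ) (h0 : 0 < l) (h1 : l ≤ 1) (B : Fin m → X) (C M s : ℝ) (hC : 0 < C) (hM : 0 < M)
    (hB : ∫⁻ ξ, ENNReal.ofReal (Real.exp (tdExpo μ g l ξ B)) ∂Q ≤ ENNReal.ofReal M)
    (hR : ρ ≤ ENNReal.ofReal C • Q)
    (hs : ∀ᵐ ξ ∂ρ, ∫ y, g ξ y ^ 2 ∂μ ≤ s) :
    ∫ ξ, (∑ i, g ξ (B i) - m * ∫ y, g ξ y ∂μ) ∂ρ ≤ m * l * s + Real.log (C * M) / l := by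
  have hm := td_expo_meas (m := m) μ g hg l
  have hm' : Measurable fun ξ => tdExpo μ g l ξ B := hm.comp (measurable_id.prodMk measurable_const)
  have hbd := fun ξ => td_expo_bdd (m := m) μ g hb l h0.le h1 ξ B
  have i1 : Integrable (fun ξ => tdExpo μ g l ξ B) ρ := td_integrable_bdd hm' _ hbd
  have i2 : Integrable (fun ξ => Real.exp (tdExpo μ g l ξ B)) ρ :=
    td_integrable_bdd hm'.exp (Real.exp (m * 3)) fun ξ => by
      rw [Real.abs_exp]; exact Real.exp_le_exp.2 (le_of_abs_le (hbd ξ))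
  have j1 : Real.exp (∫ ξ, tdExpo μ g l ξ B ∂ρ) ≤ C * M := by
    refine (convexOn_exp.map_integral_le Real.continuous_exp.continuousOn isClosed_univ
      (by simp) i1 i2).trans ?_
    rw [← ENNReal.ofReal_le_ofReal_iff (by positivity),
      ofReal_integral_eq_lintegral_ofReal i2
      (Filter.Eventually.of_forall fun _ => (Real.exp_pos _).le)]
    calc _ ≤ ∫⁻ ξ, ENNReal.ofReal (Real.exp (tdExpo μ g l ξ B)) ∂(ENNReal.ofReal C • Q) :=
          lintegral_mono' hR le_rfl
      _ = ENNReal.ofReal C * ∫⁻ ξ, ENNReal.ofReal (Real.exp (tdExpo μ g l ξ B)) ∂Q := by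
          rw [lintegral_smul_measure, smul_eq_mul]
      _ ≤ ENNReal.ofReal C * ENNReal.ofReal M := by gcongr
      _ = _ := by rw [ENNReal.ofReal_mul hC.le]
  have j2 : ∫ ξ, tdExpo μ g l ξ B ∂ρ ≤ Real.log (C * M) := by
    rwa [Real.le_log_iff_exp_le (by positivity)]
  have a1 := td_meas_int μ g hg
  have a3 : ∀ i, Measurable (fun ξ => g ξ (B i)) := fun i =>
    hg.comp (f := fun ξ => (ξ, B i)) (by fun_prop)
  have b1 : ∀ ξ, |∫ y, g ξ y ∂μ| ≤ 1 := fun ξ => by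
    have := norm_integral_le_of_norm_le_const (μ := μ) (f := g ξ) (C := 1)
      (Filter.Eventually.of_forall (hb ξ))
    simpa using this
  have i3 : Integrable (fun ξ => ∑ i, g ξ (B i) - m * ∫ y, g ξ y ∂μ) ρ := by
    refine Integrable.sub (integrable_finsetSum _ fun i _ => ?_) (Integrable.const_mul ?_ _)
    · exact td_integrable_bdd (a3 i) 1 fun ξ => hb ξ _
    · exact td_integrable_bdd a1 1 b1
  have j3 : l * ∫ ξ, (∑ i, g ξ (B i) - m * ∫ y, g ξ y ∂μ) ∂ρ - m * l ^ 2 * s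
      ≤ ∫ ξ, tdExpo μ g l ξ B ∂ρ := by
    have : l * ∫ ξ, (∑ i, g ξ (B i) - m * ∫ y, g ξ y ∂μ) ∂ρ - m * l ^ 2 * s
      = ∫ ξ, (l * (∑ i, g ξ (B i) - m * ∫ y, g ξ y ∂μ) - m * l ^ 2 * s) ∂ρ := by
      rw [integral_sub (i3.const_mul l) (integrable_const _), integral_const_mul]; simp
    rw [this]
    apply integral_mono_ae ((i3.const_mul l).sub (integrable_const _)) i1
    filter_upwards [hs] with ξ hξ
    rw [Pi.sub_apply]
    simp only [tdExpo, Finset.sum_sub_distrib, ← Finset.mul_sum, Finset.sum_const,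
      Finset.card_univ, Fintype.card_fin, nsmul_eq_mul]
    have : (m : ℝ) * (l ^ 2 * ∫ y, g ξ y ^ 2 ∂μ) ≤ m * (l ^ 2 * s) := by gcongr
    linarith
  have : ∫ ξ, (∑ i, g ξ (B i) - m * ∫ y, g ξ y ∂μ) ∂ρ - m * l * s ≤ Real.log (C * M) / l := by
    rw [le_div_iff₀ h0]; nlinarith
  linarith


lemma td_event {X Ξ : Type*} [MeasurableSpace X] [MeasurableSpace Ξ] (μ : Measure X)
    [IsProbabilityMeasure μ] (m : ℕ) (Q : Measure Ξ) [IsProbabilityMeasure Q]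
    (G : ℕ → Ξ → X → ℝ) (hG : ∀ j, Measurable (Function.uncurry (G j)))
    (hb : ∀ j ξ x, |G j ξ x| ≤ 1)
    (L : ℕ → ℝ) (N : ℕ) (hL : ∀ j < N, 0 ≤ L j ∧ L j ≤ 1) (γ : ℝ) (hγ : 0 < γ) :
    ENNReal.ofReal (1 - γ) ≤ (Measure.pi fun _ : Fin m => μ)
      {B | ∀ j < N, ∫⁻ ξ, ENNReal.ofReal (Real.exp (tdExpo μ (G j) (L j) ξ B)) ∂Q
        ≤ ENNReal.ofReal (2 ^ (j + 1) / γ)} := by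
  set P := Measure.pi fun _ : Fin m => μ
  set S := {B : Fin m → X | ∀ j < N,
    ∫⁻ ξ, ENNReal.ofReal (Real.exp (tdExpo μ (G j) (L j) ξ B)) ∂Q
        ≤ ENNReal.ofReal (2 ^ (j + 1) / γ)}
  have h1 : P Sᶜ ≤ ENNReal.ofReal γ := by
    have hsub : Sᶜ ⊆ ⋃ j ∈ Finset.range N, {B : Fin m → X | ENNReal.ofReal (2 ^ (j + 1) / γ) ≤
        ∫⁻ ξ, ENNReal.ofReal (Real.exp (tdExpo μ (G j) (L j) ξ B)) ∂Q} := by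
      intro B hB
      simp only [S, Set.mem_compl_iff, Set.mem_setOf_eq, not_forall, not_le] at hB
      obtain ⟨j, hj, h⟩ := hB
      simp only [Set.mem_iUnion, Finset.mem_range, Set.mem_setOf_eq]
      exact ⟨j, hj, h.le⟩
    refine (measure_mono hsub).trans ((measure_biUnion_finset_le _ _).trans ?_)
    calc _ ≤ ∑ j ∈ Finset.range N, ENNReal.ofReal (γ * (1 / 2) ^ (j + 1)) := by
          apply Finset.sum_le_sum
          intro j hj
          have hj' := hL j (Finset.mem_range.1 hj)
          have hpos : (0 : ℝ) < 2 ^ (j + 1) / γ := by positivity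
          refine (meas_ge_le_lintegral_div ?_ (by simpa using hpos) ENNReal.ofReal_ne_top).trans ?_
          · have hm := (((td_expo_meas (m := m) μ (G j) (hG j) (L j)).comp measurable_swap).exp).ennreal_ofReal
            exact (hm.lintegral_prod_right (ν := Q)).aemeasurable
          · refine (ENNReal.div_le_div_right (td_pb μ Q (G j) (hG j) (hb j) (L j) hj'.1 hj'.2) _).trans ?_
            rw [one_div, ← ENNReal.ofReal_inv_of_pos hpos]
            apply ENNReal.ofReal_le_ofReal
            rw [inv_div, one_div, inv_pow, div_eq_mul_inv]
      _ = ENNReal.ofReal (∑ j ∈ Finset.range N, γ * (1 / 2) ^ (j + 1)) := by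
          rw [ENNReal.ofReal_sum_of_nonneg]; intro i _; positivity
      _ ≤ ENNReal.ofReal γ := by
          apply ENNReal.ofReal_le_ofReal
          have : ∀ N : ℕ, ∑ j ∈ Finset.range N, γ * (1 / 2 : ℝ) ^ (j + 1) = γ * (1 - (1 / 2) ^ N) := by
            intro N
            induction N with
            | zero => simp
            | succ n ih => rw [Finset.sum_range_succ, ih]; ring
          rw [this]
          have : (0 : ℝ) ≤ (1 / 2) ^ N := by positivity
          nlinarith
  have h2 : 1 ≤ P S + P Sᶜ := by
    have := measure_union_le (μ := P) S Sᶜ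
    rwa [Set.union_compl_self, measure_univ] at this
  rw [ENNReal.ofReal_sub _ hγ.le, ENNReal.ofReal_one, tsub_le_iff_right]
  exact h2.trans (by gcongr)

section unif
variable {V : Type*} [NormedAddCommGroup V] [NormedSpace ℝ V] [FiniteDimensional ℝ V]
  [MeasurableSpace V] [BorelSpace V]

noncomputable def tdUnif (c : V) (r : ℝ) : Measure V :=
  cond (Measure.addHaar : Measure V) (Metric.closedBall c r)

lemma td_ball_ne_zero (c : V) (r : ℝ) (hr : 0 < r) :
    (Measure.addHaar : Measure V) (Metric.closedBall c r) ≠ 0 :=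
  (Metric.measure_closedBall_pos _ c hr).ne'

lemma td_ball_ne_top (c : V) (r : ℝ) :
    (Measure.addHaar : Measure V) (Metric.closedBall c r) ≠ ⊤ :=
  (isCompact_closedBall c r).measure_lt_top.ne

lemma td_unif_prob (c : V) (r : ℝ) (hr : 0 < r) : IsProbabilityMeasure (tdUnif c r) :=
  cond_isProbabilityMeasure_of_finite (td_ball_ne_zero c r hr) (td_ball_ne_top c r)

lemma td_unif_ae (c : V) (r : ℝ) : ∀ᵐ θ ∂(tdUnif c r), θ ∈ Metric.closedBall c r :=
  ae_cond_mem Metric.isClosed_closedBall.measurableSet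

lemma td_unif_le (c : V) (r : ℝ) (hr : 0 < r) (hr1 : r ≤ 1) (hc : ‖c‖ ≤ 1) :
    tdUnif c r ≤ ENNReal.ofReal ((2 / r) ^ Module.finrank ℝ V) • tdUnif (0 : V) 2 := by
  have hsub : Metric.closedBall c r ⊆ Metric.closedBall (0 : V) 2 := by
    apply Metric.closedBall_subset_closedBall'
    rw [dist_zero_right]; linarith
  refine Measure.le_iff.2 fun s hs => ?_
  rw [Measure.smul_apply, smul_eq_mul, tdUnif, tdUnif,
    cond_apply Metric.isClosed_closedBall.measurableSet,
    cond_apply Metric.isClosed_closedBall.measurableSet, ← mul_assoc]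
  gcongr
  rw [Measure.addHaar_closedBall _ _ hr.le, Measure.addHaar_closedBall _ _ zero_le_two]
  have hb0 : (Measure.addHaar : Measure V) (Metric.ball 0 1) ≠ 0 :=
    (Metric.measure_ball_pos _ _ one_pos).ne'
  have hbt : (Measure.addHaar : Measure V) (Metric.ball 0 1) ≠ ⊤ := measure_ball_lt_top.ne
  rw [ENNReal.mul_inv (Or.inr hbt) (Or.inr hb0), ENNReal.mul_inv (Or.inr hbt) (Or.inr hb0),
    ← mul_assoc]
  gcongr
  rw [← ENNReal.ofReal_inv_of_pos (by positivity), ← ENNReal.ofReal_inv_of_pos (by positivity),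
    ← ENNReal.ofReal_mul (by positivity)]
  apply ENNReal.ofReal_le_ofReal
  rw [div_pow]
  field_simp
  exact le_rfl

lemma td_unif_reflect (c : V) (r : ℝ) :
    MeasurePreserving (fun θ => c + c - θ) (tdUnif c r) (tdUnif c r) := by
  have h1 : MeasurePreserving (fun θ => c + c - θ) (Measure.addHaar : Measure V) Measure.addHaar :=
    Measure.measurePreserving_sub_left _ _
  have h2 := h1.restrict_preimage (s := Metric.closedBall c r)
    Metric.isClosed_closedBall.measurableSet
  have h3 : (fun θ => c + c - θ) ⁻¹' Metric.closedBall c r = Metric.closedBall c r := by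
    ext θ
    simp only [Set.mem_preimage, Metric.mem_closedBall, dist_eq_norm]
    rw [show c + c - θ - c = -(θ - c) by abel, norm_neg]
  rw [h3] at h2
  exact h2.smul_measure _

end unif


noncomputable def tdStep (a : ℝ) : ℝ := if 0 ≤ a then 1 else 0

lemma tdStep_meas : Measurable tdStep :=
  Measurable.ite measurableSet_Ici measurable_const measurable_const

lemma tdStep_cases (a : ℝ) : tdStep a = 0 ∨ tdStep a = 1 := by
  unfold tdStep; split_ifs <;> simp

noncomputable def tdG {V X : Type*} (f : V → X → ℝ) : ℕ → V × V → X → ℝ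
  | 0 => fun ξ x => tdStep (f ξ.1 x)
  | 1 => fun ξ x => tdStep (f ξ.1 x) * (1 - tdStep (f ξ.2 x))
  | _ + 2 => fun ξ x => tdStep (f ξ.1 x) - tdStep (f ξ.2 x)

noncomputable def tdL (α : ℝ) (K : ℕ) : ℕ → ℝ
  | 0 => α / 28
  | 1 => α / 28 * 2 ^ K
  | k + 2 => α / 28 * 2 ^ k

lemma tdL_bd (α : ℝ) (hα : 0 < α) (K : ℕ) (hK : 2 ^ K ≤ 28 / α) :
    ∀ j < K + 2, 0 < tdL α K j ∧ tdL α K j ≤ 1 := by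
  have key : ∀ k ≤ K, 0 < α / 28 * 2 ^ k ∧ α / 28 * (2 : ℝ) ^ k ≤ 1 := by
    intro k hk
    refine ⟨by positivity, ?_⟩
    have : (2 : ℝ) ^ k ≤ 2 ^ K := pow_le_pow_right₀ (by norm_num) hk
    calc α / 28 * (2 : ℝ) ^ k ≤ α / 28 * (28 / α) := by gcongr; linarith
      _ = 1 := by field_simp
  intro j hj
  match j with
  | 0 => simpa [tdL] using key 0 (Nat.zero_le _)
  | 1 => exact key K le_rfl
  | k + 2 => exact key k (by omega)


lemma td_step_meas2 {X V : Type*} [MeasurableSpace X] [MeasurableSpace V]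
    (f : V → X → ℝ) (hf : Measurable (Function.uncurry f)) : Measurable (Function.uncurry fun θ x => tdStep (f θ x)) :=
  tdStep_meas.comp hf

lemma tdG_meas {X V : Type*} [MeasurableSpace X] [MeasurableSpace V]
    (f : V → X → ℝ) (hf : Measurable (Function.uncurry f)) (j : ℕ) : Measurable (Function.uncurry (tdG f j)) := by
  have h := td_step_meas2 f hf
  have h1 : Measurable fun z : (V × V) × X => tdStep (f z.1.1 z.2) :=
    h.comp (f := fun z : (V × V) × X => (z.1.1, z.2)) (by fun_prop)
  have h2 : Measurable fun z : (V × V) × X => tdStep (f z.1.2 z.2) :=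
    h.comp (f := fun z : (V × V) × X => (z.1.2, z.2)) (by fun_prop)
  match j with
  | 0 => exact h1
  | 1 => exact h1.mul (measurable_const.sub h2)
  | k + 2 => exact h1.sub h2

lemma tdG_bd {X V : Type*} (f : V → X → ℝ) (j : ℕ) (ξ : V × V) (x : X) : |tdG f j ξ x| ≤ 1 := by
  match j with
  | 0 =>
    simp only [tdG]
    rcases tdStep_cases (f ξ.1 x) with h | h <;> rw [h] <;> norm_num
  | 1 =>
    simp only [tdG]
    rcases tdStep_cases (f ξ.1 x) with h | h <;> rcases tdStep_cases (f ξ.2 x) with h' | h' <;>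
      rw [h, h'] <;> norm_num
  | k + 2 =>
    simp only [tdG]
    rcases tdStep_cases (f ξ.1 x) with h | h <;> rcases tdStep_cases (f ξ.2 x) with h' | h' <;>
      rw [h, h'] <;> norm_num

lemma td_int_wedge {X V : Type*} [MeasurableSpace X] [MeasurableSpace V]
    (f : V → X → ℝ) (hf : Measurable (Function.uncurry f))
    (μ : Measure X) [IsProbabilityMeasure μ] (θ θ' : V) :
    ∫ x, tdStep (f θ x) * (1 - tdStep (f θ' x)) ∂μ
      = μ.real {x | 0 ≤ f θ x ∧ f θ' x < 0} := by
  have m1 : Measurable (f θ) := hf.comp (measurable_const.prodMk measurable_id)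
  have m2 : Measurable (f θ') := hf.comp (measurable_const.prodMk measurable_id)
  have hms : MeasurableSet {x | 0 ≤ f θ x ∧ f θ' x < 0} :=
    (measurableSet_le measurable_const m1).inter (measurableSet_lt m2 measurable_const)
  rw [← integral_indicator_one hms]
  congr 1
  ext x
  by_cases h1 : 0 ≤ f θ x <;> by_cases h2 : 0 ≤ f θ' x <;>
    simp [tdStep, Set.indicator, h1, h2]



lemma td_log_bd (n : ℕ) (D : ℝ) (hD : 1 ≤ D) (hn : (n : ℝ) ≤ 2 * D) (k : ℕ) :
    0 < (2 / (1 / 16 : ℝ) ^ (k + 1)) ^ n ∧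
    Real.log ((2 / (1 / 16 : ℝ) ^ (k + 1)) ^ n) ≤ 6 * D * (k + 2) := by
  refine ⟨by positivity, ?_⟩
  rw [Real.log_pow]
  have h2 : Real.log 2 ≤ 0.7 := by have := Real.log_two_lt_d9; linarith
  have h20 : 0 ≤ Real.log 2 := Real.log_nonneg (by norm_num)
  have h1 : Real.log (2 / (1 / 16 : ℝ) ^ (k + 1)) = (4 * k + 5) * Real.log 2 := by
    have : (2 / (1 / 16 : ℝ) ^ (k + 1)) = 2 ^ (4 * k + 5) := by
      rw [one_div, inv_pow, div_inv_eq_mul, show (16 : ℝ) = 2 ^ 4 by norm_num, ← pow_mul]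
      ring
    rw [this, Real.log_pow]; push_cast; ring
  rw [h1]
  have hk : (0 : ℝ) ≤ k := by positivity
  have h3 : (4 * k + 5) * Real.log 2 ≤ 3 * ((k : ℝ) + 2) := by nlinarith
  calc (n : ℝ) * ((4 * k + 5) * Real.log 2) ≤ (2 * D) * (3 * ((k : ℝ) + 2)) := by gcongr
    _ = _ := by ring

lemma td_log_bd2 (D γ : ℝ) (hγ : 0 < γ) (hg : Real.log (1 / γ) ≤ D) (j : ℕ) :
    0 < (2 : ℝ) ^ (j + 1) / γ ∧ Real.log ((2 : ℝ) ^ (j + 1) / γ) ≤ (j + 1) + D := by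
  refine ⟨by positivity, ?_⟩
  rw [div_eq_mul_one_div, Real.log_mul (by positivity) (by positivity), Real.log_pow]
  have h2 : Real.log 2 ≤ 1 := by have := Real.log_two_lt_d9; linarith
  push_cast
  have : ((j : ℝ) + 1) * Real.log 2 ≤ (j + 1) * 1 := by gcongr
  linarith

set_option maxHeartbeats 1000000 in
/-- The deterministic part of the chaining argument. -/
lemma td_chain {X V : Type*} [MeasurableSpace X] [NormedAddCommGroup V] [NormedSpace ℝ V]
    [FiniteDimensional ℝ V] [MeasurableSpace V] [BorelSpace V]
    (μ : Measure X) [IsProbabilityMeasure μ]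
    (f : V → X → ℝ) (hf : Measurable (Function.uncurry f))
    (hrefl : ∀ c θ x, f (c + c - θ) x = 2 * f c x - f θ x)
    (c : V) (hc : ‖c‖ ≤ 1)
    (hW : ∀ δ : ℝ, 0 < δ → δ ≤ 1 / 4 → ∀ θ ∈ Metric.closedBall c (δ ^ 2),
      ∀ θ' ∈ Metric.closedBall c (δ ^ 2), μ.real {x | 0 ≤ f θ x ∧ f θ' x < 0} ≤ 4 * δ)
    (α γ D : ℝ) (hα : 0 < α) (hα1 : α < 1) (hγ : 0 < γ) (hD : 1 ≤ D)
    (hn : (Module.finrank ℝ V : ℝ) ≤ 2 * D) (hg : Real.log (1 / γ) ≤ D)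
    (m : ℕ) (hm : 30000 * D ≤ m * α ^ 2) (K : ℕ) (hK : 2 ^ K ≤ 28 / α)
    (hK2 : 28 / α < 2 ^ (K + 1)) (B : Fin m → X)
    (hB : ∀ j < K + 2, ∫⁻ ξ, ENNReal.ofReal (Real.exp (tdExpo μ (tdG f j) (tdL α K j) ξ B))
        ∂((tdUnif (0 : V) 2).prod (tdUnif (0 : V) 2)) ≤ ENNReal.ofReal (2 ^ (j + 1) / γ)) :
    ∑ i, tdStep (f c (B i)) ≤ m * (∫ x, tdStep (f c x) ∂μ + α) := by
  classical
  set δ : ℕ → ℝ := fun k => (1 / 16 : ℝ) ^ (k + 1) with hδ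
  set ρ : ℕ → Measure V := fun k => tdUnif c (δ k) with hρ
  set Q := tdUnif (0 : V) 2
  have : IsProbabilityMeasure Q := td_unif_prob _ _ two_pos
  have hδ0 : ∀ k, 0 < δ k := fun k => by positivity
  have hδ1 : ∀ k, δ k ≤ 1 := fun k => pow_le_one₀ (by norm_num) (by norm_num)
  have hρp : ∀ k, IsProbabilityMeasure (ρ k) := fun k => td_unif_prob _ _ (hδ0 k)
  set Ck : ℕ → ℝ := fun k => (2 / δ k) ^ Module.finrank ℝ V with hCk
  have hCk0 : ∀ k, 0 < Ck k := fun k => (td_log_bd _ D hD hn k).1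
  have hCkl : ∀ k, Real.log (Ck k) ≤ 6 * D * (k + 2) := fun k => (td_log_bd _ D hD hn k).2
  have hρle : ∀ k, ρ k ≤ ENNReal.ofReal (Ck k) • Q := fun k => td_unif_le c _ (hδ0 k) (hδ1 k) hc
  have hρρ : ∀ k l, (ρ k).prod (ρ l) ≤ ENNReal.ofReal (Ck k * Ck l) • Q.prod Q := by
    intro k l
    refine (Measure.prod_mono (hρle k) (hρle l)).trans (le_of_eq ?_)
    rw [Measure.prod_smul_left, Measure.prod_smul_right, smul_smul, ENNReal.ofReal_mul (hCk0 k).le]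
  have hlog : ∀ k l j : ℕ, Real.log (Ck k * Ck l * (2 ^ (j + 1) / γ))
      ≤ 6 * D * (k + 2) + 6 * D * (l + 2) + ((j + 1) + D) := by
    intro k l j
    have h3 := td_log_bd2 D γ hγ hg j
    rw [Real.log_mul (mul_pos (hCk0 k) (hCk0 l)).ne' h3.1.ne',
      Real.log_mul (hCk0 k).ne' (hCk0 l).ne']
    linarith [hCkl k, hCkl l, h3.2]
  have hLb := tdL_bd α hα K hK
  have hW' : ∀ k, ∀ θ ∈ Metric.closedBall c (δ k), ∀ θ' ∈ Metric.closedBall c (δ k),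
      ∫ x, tdStep (f θ x) * (1 - tdStep (f θ' x)) ∂μ ≤ (1 / 4) ^ k := by
    intro k θ hθ θ' hθ'
    rw [td_int_wedge f hf]
    have e : δ k = ((1 / 4) ^ (k + 1)) ^ 2 := by
      rw [hδ, ← pow_mul, mul_comm, pow_mul]; norm_num
    rw [e] at hθ hθ'
    refine (hW ((1 / 4) ^ (k + 1)) (by positivity) ?_ θ hθ θ' hθ').trans (le_of_eq ?_)
    · rw [pow_succ]
      have : (1 / 4 : ℝ) ^ k ≤ 1 := pow_le_one₀ (by norm_num) (by norm_num)
      linarith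
    · rw [pow_succ]; ring
  have hmono : ∀ k, Metric.closedBall c (δ (k + 1)) ⊆ Metric.closedBall c (δ k) := fun k =>
    Metric.closedBall_subset_closedBall (by
      simp only [hδ]; exact pow_le_pow_of_le_one (by norm_num) (by norm_num) (by omega))
  have hstep := td_step_meas2 f hf
  have msx : ∀ x, Measurable fun θ => tdStep (f θ x) := fun x =>
    hstep.comp (measurable_id.prodMk measurable_const)
  have msθ : ∀ θ, Measurable fun x => tdStep (f θ x) := fun θ =>
    hstep.comp (measurable_const.prodMk measurable_id)
  have s01 : ∀ a, 0 ≤ tdStep a ∧ tdStep a ≤ 1 := fun a => by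
    rcases tdStep_cases a with h | h <;> rw [h] <;> norm_num
  have sabs : ∀ a, |tdStep a| ≤ 1 := fun a => by
    rw [abs_of_nonneg (s01 a).1]; exact (s01 a).2
  have isx : ∀ k x, Integrable (fun θ => tdStep (f θ x)) (ρ k) := fun k x =>
    td_integrable_bdd (msx x) 1 fun θ => sabs _
  have isθ : ∀ θ, Integrable (fun x => tdStep (f θ x)) μ := fun θ =>
    td_integrable_bdd (msθ θ) 1 fun θ => sabs _
  have iw : ∀ θ θ', Integrable (fun x => tdStep (f θ x) * (1 - tdStep (f θ' x))) μ := fun θ θ' => by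
    refine td_integrable_bdd ((msθ θ).mul (measurable_const.sub (msθ θ'))) 1 fun x => ?_
    exact tdG_bd f 1 (θ, θ') x
  set p : V → ℝ := fun θ => ∫ x, tdStep (f θ x) ∂μ with hp
  have mp : Measurable p := td_meas_int μ _ hstep
  have p01 : ∀ θ, 0 ≤ p θ ∧ p θ ≤ 1 := fun θ => by
    refine ⟨integral_nonneg fun x => (s01 _).1, ?_⟩
    calc p θ ≤ ∫ x, (1 : ℝ) ∂μ := integral_mono (isθ θ) (integrable_const _) fun x => (s01 _).2
      _ = 1 := by simp
  have ip : ∀ k, Integrable p (ρ k) := fun k => td_integrable_bdd mp 1 fun θ => by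
    rw [abs_of_nonneg (p01 θ).1]; exact (p01 θ).2
  set z : V → ℝ := fun θ => ∑ i, tdStep (f θ (B i)) - m * p θ with hz
  have iz : ∀ k, Integrable z (ρ k) := fun k =>
    (integrable_finsetSum _ fun i _ => isx k (B i)).sub ((ip k).const_mul _)
  set Z : ℕ → ℝ := fun k => ∫ θ, z θ ∂(ρ k) with hZ
  have hsmall : ∀ L : ℝ, ∀ q : ℝ, ∀ k : ℕ, L ≤ q * D → 0 ≤ q →
      L / (α / 28 * 2 ^ k) ≤ m * α * (q * (28 / 30000)) * (1 / 2) ^ k := by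
    intro L q k hL hq
    rw [div_le_iff₀ (by positivity)]
    have e : (1 / 2 : ℝ) ^ k * 2 ^ k = 1 := by rw [← mul_pow]; norm_num
    calc L ≤ q * D := hL
      _ ≤ q * (m * α ^ 2 / 30000) := by gcongr; linarith
      _ = m * α * (q * (28 / 30000)) * (α / 28) * ((1 / 2 : ℝ) ^ k * 2 ^ k) := by rw [e]; ring
      _ = _ := by ring
  have c0 : Z 0 ≤ m * α * (1 / 28 + 26 * (28 / 30000)) := by
    have h := td_dev μ (Q.prod Q) ((ρ 0).prod (ρ 0)) (tdG f 0) (tdG_meas f hf 0) (tdG_bd f 0)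
      (tdL α K 0) (hLb 0 (by omega)).1 (hLb 0 (by omega)).2 B (Ck 0 * Ck 0) (2 ^ (0 + 1) / γ) 1
      (mul_pos (hCk0 0) (hCk0 0)) (by positivity) (hB 0 (by omega)) (hρρ 0 0)
      (Filter.Eventually.of_forall fun ξ => by
        simp only [tdG]
        calc _ ≤ ∫ x, (1 : ℝ) ∂μ := by
              apply integral_mono _ (integrable_const _)
              · intro x; exact pow_le_one₀ (s01 _).1 (s01 _).2
              · exact td_integrable_bdd ((msθ _).pow_const 2) 1 fun x => by
                  rw [abs_pow]; exact pow_le_one₀ (abs_nonneg _) (sabs _)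
          _ = 1 := by simp)
    have e1 : ∫ ξ, (∑ i, tdG f 0 ξ (B i) - m * ∫ y, tdG f 0 ξ y ∂μ) ∂((ρ 0).prod (ρ 0)) = Z 0 := by
      have := integral_fun_fst (μ := ρ 0) (ν := ρ 0) z
      simp only [probReal_univ, one_smul] at this
      exact this
    rw [e1] at h
    have h4 := hsmall _ 26 0 ((hlog 0 0 0).trans (by push_cast; linarith)) (by norm_num)
    simp only [tdL] at h
    simp only [pow_zero, mul_one] at h4
    refine h.trans ?_
    linarith
  have ck : ∀ k < K, Z (k + 1) - Z k
      ≤ m * α * ((2 / 28) * (1 / 2) ^ k + 14 * (28 / 30000) * ((k + 3) * (1 / 2) ^ k)) := by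
    intro k hk
    have h := td_dev μ (Q.prod Q) ((ρ (k + 1)).prod (ρ k)) (tdG f (k + 2)) (tdG_meas f hf _)
      (tdG_bd f _)
      (tdL α K (k + 2)) (hLb _ (by omega)).1 (hLb _ (by omega)).2 B (Ck (k + 1) * Ck k)
      (2 ^ ((k + 2) + 1) / γ) (2 * (1 / 4) ^ k)
      (mul_pos (hCk0 _) (hCk0 _)) (by positivity) (hB _ (by omega)) (hρρ _ _) (by
        have a1 : ∀ᵐ ξ ∂((ρ (k + 1)).prod (ρ k)), ξ.1 ∈ Metric.closedBall c (δ (k + 1)) :=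
          Measure.quasiMeasurePreserving_fst.ae (td_unif_ae c _)
        have a2 : ∀ᵐ ξ ∂((ρ (k + 1)).prod (ρ k)), ξ.2 ∈ Metric.closedBall c (δ k) :=
          Measure.quasiMeasurePreserving_snd.ae (td_unif_ae c _)
        filter_upwards [a1, a2] with ξ h1 h2
        have w1 := hW' k ξ.1 (hmono k h1) ξ.2 h2
        have w2 := hW' k ξ.2 h2 ξ.1 (hmono k h1)
        calc ∫ y, tdG f (k + 2) ξ y ^ 2 ∂μ
            = ∫ x, (tdStep (f ξ.1 x) * (1 - tdStep (f ξ.2 x))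
              + tdStep (f ξ.2 x) * (1 - tdStep (f ξ.1 x))) ∂μ := by
              congr 1; ext x
              simp only [tdG]
              rcases tdStep_cases (f ξ.1 x) with h | h <;>
                rcases tdStep_cases (f ξ.2 x) with h' | h' <;> rw [h, h'] <;> norm_num
          _ = _ := integral_add (iw _ _) (iw _ _)
          _ ≤ _ := by linarith)
    have e1 : ∫ ξ, (∑ i, tdG f (k + 2) ξ (B i) - m * ∫ y, tdG f (k + 2) ξ y ∂μ)
        ∂((ρ (k + 1)).prod (ρ k)) = Z (k + 1) - Z k := by
      have g1 := integral_fun_fst (μ := ρ (k + 1)) (ν := ρ k) z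
      have g2 := integral_fun_snd (μ := ρ (k + 1)) (ν := ρ k) z
      simp only [probReal_univ, one_smul] at g1 g2
      simp only [hZ]
      rw [← g1, ← g2, ← integral_sub ((iz (k + 1)).comp_fst _) ((iz k).comp_snd _)]
      congr 1
      ext ξ
      simp only [tdG, hz, hp]
      rw [integral_sub (isθ _) (isθ _), Finset.sum_sub_distrib]
      ring
    rw [e1] at h
    have h4 := hsmall _ (14 * (k + 3)) k
      ((hlog (k + 1) k (k + 2)).trans (by
        push_cast
        have : (0 : ℝ) ≤ k := by positivity
        nlinarith [mul_nonneg this (sub_nonneg.2 hD)])) (by positivity)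
    simp only [tdL] at h
    refine h.trans ?_
    have e5 : (m : ℝ) * (α / 28 * 2 ^ k) * (2 * (1 / 4) ^ k)
        = m * α * (2 / 28) * (1 / 2) ^ k := by
      have : (2 : ℝ) ^ k * (1 / 4) ^ k = (1 / 2) ^ k := by rw [← mul_pow]; norm_num
      rw [← this]; ring
    rw [e5]
    linarith
  have csum : ∀ j ≤ K, Z j ≤ Z 0 + m * α * ((2 / 28) * (2 - 2 * (1 / 2) ^ j)
      + 14 * (28 / 30000) * (8 - (2 * j + 8) * (1 / 2) ^ j)) := by
    intro j
    induction j with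
    | zero => intro _; simp
    | succ j ih =>
      intro hj
      have h1 := ih (by omega)
      have h2 := ck j (by omega)
      have e : (1 / 2 : ℝ) ^ (j + 1) = (1 / 2) ^ j / 2 := by rw [pow_succ]; ring
      rw [e]
      push_cast
      nlinarith
  have hmα : 0 ≤ (m : ℝ) * α := by positivity
  have hKtail : (0 : ℝ) < (1 / 2) ^ K := by positivity
  have cK : Z K ≤ m * α * (1 / 28 + 26 * (28 / 30000) + (4 / 28) + 14 * (28 / 30000) * 8) := by
    have h1 := csum K le_rfl
    have h2 : (2 / 28 : ℝ) * (2 - 2 * (1 / 2) ^ K)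
      + 14 * (28 / 30000) * (8 - (2 * K + 8) * (1 / 2) ^ K) ≤ 4 / 28 + 14 * (28 / 30000) * 8 := by
      have : (0 : ℝ) ≤ (2 * K + 8) * (1 / 2) ^ K := by positivity
      linarith
    have h3 := mul_le_mul_of_nonneg_left h2 hmα
    linarith
  have hPw : ∀ᵐ ξ ∂((ρ K).prod (ρ K)), ∫ y, tdG f 1 ξ y ∂μ ≤ (1 / 4) ^ K := by
    have a1 : ∀ᵐ ξ ∂((ρ K).prod (ρ K)), ξ.1 ∈ Metric.closedBall c (δ K) :=
      Measure.quasiMeasurePreserving_fst.ae (td_unif_ae c _)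
    have a2 : ∀ᵐ ξ ∂((ρ K).prod (ρ K)), ξ.2 ∈ Metric.closedBall c (δ K) :=
      Measure.quasiMeasurePreserving_snd.ae (td_unif_ae c _)
    filter_upwards [a1, a2] with ξ h1 h2
    exact hW' K ξ.1 h1 ξ.2 h2
  set F : X → ℝ := fun x => ∫ θ, tdStep (f θ x) ∂(ρ K) with hF
  have cf : ∑ i, F (B i) * (1 - F (B i)) ≤ m * (1 / 4) ^ K
      + m * α * (1 / 28 + 15 * (28 / 30000) * 2) := by
    have h := td_dev μ (Q.prod Q) ((ρ K).prod (ρ K)) (tdG f 1) (tdG_meas f hf 1) (tdG_bd f 1)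
      (tdL α K 1) (hLb 1 (by omega)).1 (hLb 1 (by omega)).2 B (Ck K * Ck K) (2 ^ (1 + 1) / γ)
      ((1 / 4) ^ K)
      (mul_pos (hCk0 _) (hCk0 _)) (by positivity) (hB 1 (by omega)) (hρρ _ _) (by
        filter_upwards [hPw] with ξ h1
        refine le_trans (le_of_eq ?_) h1
        congr 1; ext x
        simp only [tdG]
        rcases tdStep_cases (f ξ.1 x) with h | h <;>
          rcases tdStep_cases (f ξ.2 x) with h' | h' <;> rw [h, h'] <;> norm_num)
    have mw : ∀ x, Measurable fun ξ : V × V => tdG f 1 ξ x := fun x =>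
      (tdG_meas f hf 1).comp (f := fun ξ => (ξ, x)) (by fun_prop)
    have iwx : ∀ x, Integrable (fun ξ : V × V => tdG f 1 ξ x) ((ρ K).prod (ρ K)) := fun x =>
      td_integrable_bdd (mw x) 1 fun ξ => tdG_bd f 1 ξ x
    have iwp : Integrable (fun ξ : V × V => ∫ y, tdG f 1 ξ y ∂μ) ((ρ K).prod (ρ K)) := by
      refine td_integrable_bdd (td_meas_int μ _ (tdG_meas f hf 1)) 1 fun ξ => ?_
      have := norm_integral_le_of_norm_le_const (μ := μ) (f := tdG f 1 ξ) (C := 1)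
        (Filter.Eventually.of_forall (tdG_bd f 1 ξ))
      simpa using this
    rw [integral_sub (integrable_finsetSum _ fun i _ => iwx (B i)) (iwp.const_mul _),
      integral_finsetSum _ fun i _ => iwx (B i), integral_const_mul] at h
    have e1 : ∀ x, ∫ ξ, tdG f 1 ξ x ∂((ρ K).prod (ρ K)) = F x * (1 - F x) := by
      intro x
      have := integral_prod_mul (μ := ρ K) (ν := ρ K) (fun θ => tdStep (f θ x))
        (fun θ => 1 - tdStep (f θ x))
      rw [integral_sub (integrable_const _) (isx K x)] at this
      simp only [integral_const, probReal_univ, one_smul] at this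
      exact this
    simp only [e1] at h
    have h2 : ∫ ξ, ∫ y, tdG f 1 ξ y ∂μ ∂((ρ K).prod (ρ K)) ≤ (1 / 4) ^ K := by
      refine (integral_mono_ae iwp (integrable_const _) hPw).trans (by simp)
    have h3 : (m : ℝ) * ∫ ξ, ∫ y, tdG f 1 ξ y ∂μ ∂((ρ K).prod (ρ K)) ≤ m * (1 / 4) ^ K := by
      gcongr
    have h4 := hsmall _ (15 * (K + 2)) K
      ((hlog K K 1).trans (by
        push_cast
        have : (0 : ℝ) ≤ K := by positivity
        nlinarith [mul_nonneg this (sub_nonneg.2 hD)])) (by positivity)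
    simp only [tdL] at h
    have e5 : (m : ℝ) * (α / 28 * 2 ^ K) * (1 / 4) ^ K
        = m * α * (1 / 28) * (1 / 2) ^ K := by
      have : (2 : ℝ) ^ K * (1 / 4) ^ K = (1 / 2) ^ K := by rw [← mul_pow]; norm_num
      rw [← this]; ring
    rw [e5] at h
    have h6 : (1 / 2 : ℝ) ^ K ≤ 1 := pow_le_one₀ (by norm_num) (by norm_num)
    have h7 : ((K : ℝ) + 2) * (1 / 2) ^ K ≤ 2 := by
      have : (K : ℝ) + 2 ≤ 2 * 2 ^ K := by
        have h := Nat.lt_two_pow_self (n := K)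
        have : (K : ℝ) + 1 ≤ 2 ^ K := by exact_mod_cast h
        have : (1 : ℝ) ≤ 2 ^ K := one_le_pow₀ (by norm_num)
        linarith
      have e : (1 / 2 : ℝ) ^ K * 2 ^ K = 1 := by rw [← mul_pow]; norm_num
      nlinarith
    have h8 : (m : ℝ) * α * (1 / 28) * (1 / 2) ^ K ≤ m * α * (1 / 28) * 1 := by gcongr
    have h9 : (m : ℝ) * α * (15 * (28 / 30000)) * (((K : ℝ) + 2) * (1 / 2) ^ K)
      ≤ m * α * (15 * (28 / 30000)) * 2 := by gcongr
    linarith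
  have hF01 : ∀ x, 0 ≤ F x ∧ F x ≤ 1 := fun x => by
    refine ⟨integral_nonneg fun θ => (s01 _).1, ?_⟩
    calc F x ≤ ∫ θ, (1 : ℝ) ∂(ρ K) := integral_mono (isx K x) (integrable_const _) fun θ => (s01 _).2
      _ = 1 := by simp
  have hhalf : ∀ x, 0 ≤ f c x → 1 / 2 ≤ F x := by
    intro x hx
    have hr := td_unif_reflect c (δ K)
    have e1 : ∫ θ, tdStep (f (c + c - θ) x) ∂(ρ K) = F x := by
      have := hr.map_eq
      have h := integral_map (μ := tdUnif c (δ K)) hr.measurable.aemeasurable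
        (f := fun θ => tdStep (f θ x)) (msx x).aestronglyMeasurable
      rw [hr.map_eq] at h
      exact h.symm
    have i1 : Integrable (fun θ => tdStep (f (c + c - θ) x)) (ρ K) :=
      td_integrable_bdd ((msx x).comp hr.measurable) 1 fun θ => sabs _
    have : (1 : ℝ) ≤ F x + F x := by
      nth_rewrite 2 [← e1]
      rw [hF, ← integral_add (isx K x) i1]
      calc (1 : ℝ) = ∫ θ, (1 : ℝ) ∂(ρ K) := by simp
        _ ≤ _ := by
          apply integral_mono (integrable_const _) ((isx K x).add i1)
          intro θ
          simp only [hrefl, Pi.add_apply]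
          by_cases h1 : 0 ≤ f θ x
          · have := (s01 (2 * f c x - f θ x)).1
            have h2 : tdStep (f θ x) = 1 := by simp [tdStep, h1]
            linarith
          · have := (s01 (f θ x)).1
            have h2 : tdStep (2 * f c x - f θ x) = 1 := by
              simp only [tdStep]; rw [if_pos]; linarith
            linarith
    linarith
  have hpt : ∀ x, tdStep (f c x) ≤ F x + 2 * (F x * (1 - F x)) := by
    intro x
    have := hF01 x
    by_cases h : 0 ≤ f c x
    · have h2 := hhalf x h
      have : tdStep (f c x) = 1 := by simp [tdStep, h]
      nlinarith
    · have : tdStep (f c x) = 0 := by simp [tdStep, h]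
      nlinarith
  have hsumF : ∑ i, F (B i) = Z K + m * ∫ θ, p θ ∂(ρ K) := by
    simp only [hZ, hz]
    rw [integral_sub (integrable_finsetSum _ fun i _ => isx K (B i)) ((ip K).const_mul _),
      integral_finsetSum _ fun i _ => isx K (B i), integral_const_mul]
    ring
  have hpK : ∫ θ, p θ ∂(ρ K) ≤ p c + (1 / 4) ^ K := by
    have : ∀ᵐ θ ∂(ρ K), p θ ≤ p c + (1 / 4) ^ K := by
      filter_upwards [td_unif_ae c (δ K)] with θ hθ
      have h1 := hW' K θ hθ c (Metric.mem_closedBall_self (hδ0 K).le)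
      calc p θ ≤ ∫ x, (tdStep (f c x) + tdStep (f θ x) * (1 - tdStep (f c x))) ∂μ := by
            apply integral_mono (isθ _) ((isθ _).add (iw _ _))
            intro x
            simp only [Pi.add_apply]
            rcases tdStep_cases (f θ x) with h | h <;>
              rcases tdStep_cases (f c x) with h' | h' <;> rw [h, h'] <;> norm_num
        _ = p c + ∫ x, tdStep (f θ x) * (1 - tdStep (f c x)) ∂μ := integral_add (isθ _) (iw _ _)
        _ ≤ _ := by linarith
    exact (integral_mono_ae (ip K) (integrable_const _) this).trans (by simp)
  have hpK' : (m : ℝ) * ∫ θ, p θ ∂(ρ K) ≤ m * (p c + (1 / 4) ^ K) := by gcongr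
  have h4K : (1 / 4 : ℝ) ^ K ≤ α / 196 := by
    have e : (1 / 2 : ℝ) ^ K * 2 ^ K = 1 := by rw [← mul_pow]; norm_num
    have h1 : (1 / 2 : ℝ) ^ K ≤ α / 14 := by
      rw [div_lt_iff₀ hα, pow_succ] at hK2
      nlinarith
    have : (1 / 4 : ℝ) ^ K = (1 / 2) ^ K * (1 / 2) ^ K := by rw [← mul_pow]; norm_num
    rw [this]
    calc (1 / 2 : ℝ) ^ K * (1 / 2) ^ K ≤ α / 14 * (α / 14) := by gcongr
      _ ≤ α / 196 := by nlinarith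
  have h4K' : (m : ℝ) * (1 / 4) ^ K ≤ m * (α / 196) := by gcongr
  calc ∑ i, tdStep (f c (B i)) ≤ ∑ i, (F (B i) + 2 * (F (B i) * (1 - F (B i)))) :=
        Finset.sum_le_sum fun i _ => hpt _
    _ = ∑ i, F (B i) + 2 * ∑ i, F (B i) * (1 - F (B i)) := by
        rw [Finset.sum_add_distrib, Finset.mul_sum]
    _ ≤ m * (p c + α) := by
        rw [hsumF]
        have hpc : (m : ℝ) * (p c + (1 / 4) ^ K) = m * p c + m * (1 / 4) ^ K := mul_add _ _ _
        have hpc2 : (m : ℝ) * (p c + α) = m * p c + m * α := mul_add _ _ _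
        have hq : (m : ℝ) * (α / 196) = m * α / 196 := by ring
        rw [hpc] at hpK'
        rw [hq] at h4K'
        rw [hpc2]
        linarith


lemma td_pdf_le (v : ℝ≥0) (hv : v ≠ 0) (x : ℝ) (h : (15 / 16 : ℝ) ^ 2 ≤ v ∨ 15 / 16 ≤ x) :
    gaussianPDFReal 0 v x ≤ 1 := by
  have hv0 : (0 : ℝ) < v := by positivity
  rw [gaussianPDFReal]
  have hpi := Real.pi_gt_three
  set t := (x - 0) ^ 2 / (2 * (v : ℝ)) with ht
  have ht0 : 0 ≤ t := by positivity
  have e : -(x - 0) ^ 2 / (2 * (v : ℝ)) = -t := by rw [ht]; ring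
  rw [e, Real.exp_neg, ← mul_inv]
  apply inv_le_one_of_one_le₀
  have h1 : 1 + t ≤ Real.exp t := by linarith [Real.add_one_le_exp t]
  have h2 : 1 ≤ √(2 * Real.pi * v) * (1 + t) := by
    rw [← one_le_sq_iff₀ (by positivity), mul_pow, Real.sq_sqrt (by positivity)]
    rcases h with h | h
    · have : 1 ≤ 2 * Real.pi * v := by nlinarith
      have : 1 ≤ (1 + t) ^ 2 := by nlinarith
      nlinarith
    · have h3 : 4 * t ≤ (1 + t) ^ 2 := by nlinarith [sq_nonneg (1 - t)]
      have h4 : 2 * Real.pi * v * (4 * t) = 4 * Real.pi * x ^ 2 := by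
        rw [ht]; field_simp; ring
      have h5 : 2 * Real.pi * v * (4 * t) ≤ 2 * Real.pi * v * (1 + t) ^ 2 := by gcongr
      rw [h4] at h5
      nlinarith
  exact h2.trans (by gcongr)

lemma td_gauss_interval (v : ℝ≥0) (a b : ℝ) (hab : a ≤ b) (h : (15 / 16 : ℝ) ^ 2 ≤ v ∨ 15 / 16 ≤ a) :
    (gaussianReal 0 v).real (Set.Icc a b) ≤ b - a := by
  by_cases hv : v = 0
  · subst hv
    have ha : 15 / 16 ≤ a := by
      rcases h with h | h
      · exfalso; norm_num at h
      · exact h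
    rw [gaussianReal_zero_var]
    have : (0 : ℝ) ∉ Set.Icc a b := fun h => by linarith [h.1]
    rw [measureReal_def, Measure.dirac_apply' _ measurableSet_Icc]
    simp [this, hab]
  · rw [measureReal_def]
    apply ENNReal.toReal_le_of_le_ofReal (by linarith)
    rw [gaussianReal_apply _ hv]
    calc _ ≤ ∫⁻ x in Set.Icc a b, 1 := by
          apply setLIntegral_mono' measurableSet_Icc
          intro x hx
          rw [gaussianPDF, ENNReal.ofReal_le_one]
          exact td_pdf_le v hv x (h.imp id fun h => h.trans hx.1)
      _ = _ := by simp

lemma td_gauss_cheb (v : ℝ≥0) (δ : ℝ) (hδ : 0 < δ) :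
    (gaussianReal 0 v).real {x | δ ≤ |x|} ≤ v / δ ^ 2 := by
  have h := meas_ge_le_variance_div_sq (μ := gaussianReal 0 v) (X := id)
    (memLp_id_gaussianReal 2) hδ
  rw [variance_id_gaussianReal] at h
  simp only [id, integral_id_gaussianReal, sub_zero] at h
  exact ENNReal.toReal_le_of_le_ofReal (by positivity) h

abbrev TdE (d : ℕ) := EuclideanSpace ℝ (Fin d)

noncomputable def tdF {X : Type*} {d : ℕ} (φ : X → TdE d) (θ : TdE d × ℝ) (x : X) : ℝ :=
  inner ℝ θ.1 (φ x) - θ.2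

lemma td_wedge {X : Type*} [MeasurableSpace X] {d : ℕ} (μ : Measure X) [IsProbabilityMeasure μ]
    (φ : X → TdE d) (hφ : Measurable φ)
    (hlaw : ∀ w : TdE d, μ.map (fun x => inner ℝ w (φ x)) = gaussianReal 0 (Real.toNNReal (‖w‖ ^ 2)))
    (c : TdE d × ℝ) (hc : ‖c.1‖ = 1 ∨ c.2 = 1) (δ : ℝ) (hδ : 0 < δ) (hδ1 : δ ≤ 1 / 4)
    (θ θ' : TdE d × ℝ) (hθ : θ ∈ Metric.closedBall c (δ ^ 2))
    (hθ' : θ' ∈ Metric.closedBall c (δ ^ 2)) :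
    μ.real {x | 0 ≤ tdF φ θ x ∧ tdF φ θ' x < 0} ≤ 4 * δ := by
  have hmw : ∀ w : TdE d, Measurable fun x => inner ℝ w (φ x) := fun w =>
    hφ.const_inner
  obtain ⟨u, r⟩ := θ
  obtain ⟨u', r'⟩ := θ'
  obtain ⟨v, s⟩ := c
  rw [Metric.mem_closedBall, Prod.dist_eq, max_le_iff] at hθ hθ'
  simp only [dist_eq_norm] at hθ hθ'
  obtain ⟨hu, hr⟩ := hθ
  obtain ⟨hu', hr'⟩ := hθ'
  rw [Real.norm_eq_abs, abs_le] at hr hr'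
  have hδ2 : δ ^ 2 ≤ 1 / 16 := by nlinarith
  have huu : ‖u - u'‖ ≤ 2 * δ ^ 2 := by
    calc ‖u - u'‖ = ‖(u - v) - (u' - v)‖ := by congr 1; abel
      _ ≤ ‖u - v‖ + ‖u' - v‖ := norm_sub_le _ _
      _ ≤ _ := by linarith
  have hsub : {x | 0 ≤ tdF φ (u, r) x ∧ tdF φ (u', r') x < 0} ⊆
      (fun x => inner ℝ (u - u') (φ x)) ⁻¹' {y | δ ≤ |y|} ∪
      (fun x => inner ℝ u (φ x)) ⁻¹' Set.Icc r (r + (2 * δ ^ 2 + δ)) := by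
    rintro x ⟨h1, h2⟩
    simp only [tdF] at h1 h2
    by_cases h : δ ≤ |inner ℝ (u - u') (φ x)|
    · exact Or.inl h
    · right
      rw [not_le, abs_lt, inner_sub_left] at h
      constructor
      · dsimp only; linarith
      · dsimp only; linarith [h.2, hr.1, hr.2, hr'.1, hr'.2]
  have hS1 : MeasurableSet {y : ℝ | δ ≤ |y|} := measurableSet_le measurable_const (by fun_prop)
  have b1 : μ.real ((fun x => inner ℝ (u - u') (φ x)) ⁻¹' {y | δ ≤ |y|}) ≤ 4 * δ ^ 2 := by
    rw [← map_measureReal_apply (hmw _) hS1, hlaw]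
    refine (td_gauss_cheb _ δ hδ).trans ?_
    rw [Real.coe_toNNReal _ (by positivity), div_le_iff₀ (by positivity)]
    calc ‖u - u'‖ ^ 2 ≤ (2 * δ ^ 2) ^ 2 := by gcongr
      _ = _ := by ring
  have b2 : μ.real ((fun x => inner ℝ u (φ x)) ⁻¹' Set.Icc r (r + (2 * δ ^ 2 + δ)))
      ≤ 2 * δ ^ 2 + δ := by
    rw [← map_measureReal_apply (hmw _) measurableSet_Icc, hlaw]
    refine (td_gauss_interval _ _ _ (by nlinarith) ?_).trans (by linarith)
    rw [Real.coe_toNNReal _ (by positivity)]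
    rcases hc with hc | hc
    · left
      dsimp only at hc
      have : ‖v‖ - ‖u‖ ≤ ‖u - v‖ := by
        rw [norm_sub_rev]; exact norm_sub_norm_le _ _
      gcongr
      linarith
    · right
      dsimp only at hc
      linarith [hr.1]
  calc _ ≤ _ := measureReal_mono hsub
    _ ≤ _ := measureReal_union_le _ _
    _ ≤ 4 * δ ^ 2 + (2 * δ ^ 2 + δ) := add_le_add b1 b2
    _ ≤ _ := by nlinarith

lemma td_main {X : Type*} [MeasurableSpace X] {d : ℕ} (hd : 1 ≤ d) (μ : Measure X)
    [IsProbabilityMeasure μ]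
    (φ : X → TdE d) (hφ : Measurable φ)
    (hlaw : ∀ w : TdE d, μ.map (fun x => inner ℝ w (φ x)) = gaussianReal 0 (Real.toNNReal (‖w‖ ^ 2)))
    (α γ : ℝ) (hα : 0 < α) (hα1 : α < 1) (hγ : 0 < γ) (hγ1 : γ < 1)
    (m : ℕ) (hm : 30000 * ((d : ℝ) + Real.log (1 / γ)) / α ^ 2 ≤ (m : ℝ)) :
    ENNReal.ofReal (1 - γ) ≤ (Measure.pi fun _ : Fin m => μ)
      {B | ∀ w : TdE d, ‖w‖ = 1 → ∀ t : ℝ, 0 ≤ t →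
        ∑ i, tdStep (inner ℝ w (φ (B i)) - t) ≤ m * (1 - cdf (gaussianReal 0 1) t + α)} := by
  have hmw : ∀ w : TdE d, Measurable fun x => inner ℝ w (φ x) := fun w =>
    hφ.const_inner
  obtain ⟨K, hK1, hK2⟩ := exists_nat_pow_near (x := 28 / α) (y := 2)
    (by rw [le_div_iff₀ hα]; linarith) (by norm_num)
  have hf : Measurable (Function.uncurry (tdF φ)) := by
    have : Measurable fun z : (TdE d × ℝ) × X => inner ℝ z.1.1 (φ z.2) - z.1.2 :=
      ((measurable_fst.comp measurable_fst).inner (hφ.comp measurable_snd)).sub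
        (measurable_snd.comp measurable_fst)
    exact this
  have : IsProbabilityMeasure (tdUnif (0 : TdE d × ℝ) 2) := td_unif_prob _ _ two_pos
  have hlogγ : 0 ≤ Real.log (1 / γ) := Real.log_nonneg (by rw [le_div_iff₀ hγ]; linarith)
  have hd' : (1 : ℝ) ≤ d := by exact_mod_cast hd
  refine (td_event μ m ((tdUnif (0 : TdE d × ℝ) 2).prod (tdUnif (0 : TdE d × ℝ) 2))
    (tdG (tdF φ)) (tdG_meas _ hf) (tdG_bd _) (tdL α K) (K + 2)
    (fun j hj => ⟨(tdL_bd α hα K hK1 j hj).1.le, (tdL_bd α hα K hK1 j hj).2⟩) γ hγ).trans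
    (measure_mono fun B hB => ?_)
  intro w hw t ht
  set M := max 1 t
  have hM1 : 1 ≤ M := le_max_left _ _
  have hM0 : 0 < M := by linarith
  have htM : t ≤ M := le_max_right _ _
  set c : TdE d × ℝ := (M⁻¹ • w, M⁻¹ * t) with hcdef
  have hstep : ∀ x, tdStep (tdF φ c x) = tdStep (inner ℝ w (φ x) - t) := by
    intro x
    have : tdF φ c x = M⁻¹ * (inner ℝ w (φ x) - t) := by
      simp only [tdF, hcdef, inner_smul_left]; simp; ring
    rw [this, tdStep, tdStep]
    congr 1
    rw [mul_nonneg_iff_of_pos_left (by positivity)]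
  have hn1 : ‖c.1‖ = M⁻¹ := by
    simp only [hcdef]; rw [norm_smul, hw, Real.norm_of_nonneg (by positivity), mul_one]
  have hc1 : ‖c‖ ≤ 1 := by
    rw [Prod.norm_def, max_le_iff]
    refine ⟨by rw [hn1]; exact inv_le_one_of_one_le₀ hM1, ?_⟩
    rw [Real.norm_of_nonneg (by positivity)]
    simp only [hcdef]
    rw [inv_mul_le_iff₀ hM0]; linarith
  have hc2 : ‖c.1‖ = 1 ∨ c.2 = 1 := by
    rcases le_total t 1 with h | h
    · left; rw [hn1, show M = 1 from max_eq_left h]; simp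
    · right; simp only [hcdef]; rw [show M = t from max_eq_right h]
      exact inv_mul_cancel₀ (by linarith)
  have key := td_chain μ (tdF φ) hf (fun c θ x => by
      simp only [tdF, Prod.fst_sub, Prod.fst_add, Prod.snd_sub, Prod.snd_add, inner_sub_left,
        inner_add_left]; ring) c hc1
    (fun δ h1 h2 θ hθ θ' hθ' => td_wedge μ φ hφ hlaw c hc2 δ h1 h2 θ θ' hθ hθ')
    α γ ((d : ℝ) + Real.log (1 / γ)) hα hα1 hγ (by linarith)
    (by
      simp only [Module.finrank_prod, finrank_euclideanSpace, Fintype.card_fin, Module.finrank_self]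
      push_cast; linarith) (by linarith) m (by rwa [div_le_iff₀ (by positivity)] at hm)
    K hK1 hK2 B hB
  simp only [hstep] at key
  refine key.trans (le_of_eq ?_)
  congr 2
  have hS : MeasurableSet (Set.Ici t) := measurableSet_Ici
  have e1 : (fun x => tdStep (inner ℝ w (φ x) - t))
      = ((fun x => inner ℝ w (φ x)) ⁻¹' Set.Ici t).indicator 1 := by
    ext x
    simp [tdStep, Set.indicator]
  rw [e1, integral_indicator_one ((hmw w) hS), ← map_measureReal_apply (hmw w) hS, hlaw, hw]
  simp only [one_pow, Real.toNNReal_one]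
  have : NullSingletonClass (gaussianReal 0 1) := nullSingletonClass_gaussianReal one_ne_zero
  rw [cdf_eq_real, ← Set.compl_Iio, probReal_compl_eq_one_sub measurableSet_Iio]
  congr 1
  rw [measureReal_def, measureReal_def, measure_congr Iio_ae_eq_Iic]


lemma td_cdf_sub (a b : ℝ) (h : a ≤ b) :
    stdGaussianCDF b - stdGaussianCDF a = (gaussianReal 0 1).real (Set.Ioc a b) := by
  unfold stdGaussianCDF
  conv_rhs => rw [← measure_cdf (gaussianReal 0 1)]
  rw [Measure.real, StieltjesFunction.measure_Ioc, ENNReal.toReal_ofReal]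
  linarith [monotone_cdf (gaussianReal 0 1) h]

lemma td_cdf_strictMono : StrictMono stdGaussianCDF := by
  intro a b hab
  have h := td_cdf_sub a b hab.le
  have hpos : 0 < (gaussianReal 0 1).real (Set.Ioc a b) := by
    rw [Measure.real, ENNReal.toReal_pos_iff]
    refine ⟨?_, measure_lt_top _ _⟩
    rw [pos_iff_ne_zero]
    intro h0
    have := gaussianReal_absolutelyContinuous' 0 (one_ne_zero) h0
    rw [Real.volume_Ioc, ENNReal.ofReal_eq_zero] at this
    linarith
  linarith

lemma td_cdf_cont : Continuous stdGaussianCDF := by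
  have key : ∀ a b, a ≤ b → |stdGaussianCDF b - stdGaussianCDF a| ≤ b - a := by
    intro a b hab
    have h := td_gauss_interval 1 a b hab (Or.inl (by norm_num))
    rw [td_cdf_sub a b hab, abs_of_nonneg measureReal_nonneg]
    exact le_trans (measureReal_mono Set.Ioc_subset_Icc_self) h
  refine (LipschitzWith.of_dist_le_mul (K := 1) ?_).continuous
  intro x y
  rw [Real.dist_eq, Real.dist_eq, NNReal.coe_one, one_mul]
  rcases le_total x y with h | h
  · rw [abs_sub_comm, abs_sub_comm x y, abs_of_nonneg (sub_nonneg.mpr h)]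
    exact key x y h
  · rw [abs_of_nonneg (sub_nonneg.mpr h)]
    exact key y x h

lemma td_inv (q r : ℝ) (h0 : 0 < q) (h1 : q < 1) (h : stdGaussianCDF r ≤ q) :
    r ≤ stdGaussianCDFInv q := by
  have hex : ∃ x, stdGaussianCDF x = q := by
    obtain ⟨a, ha⟩ := ((tendsto_cdf_atBot (gaussianReal 0 1)).eventually (gt_mem_nhds h0)).exists
    obtain ⟨b, hb⟩ := ((tendsto_cdf_atTop (gaussianReal 0 1)).eventually (lt_mem_nhds h1)).exists
    exact mem_range_of_exists_le_of_exists_ge td_cdf_cont ⟨a, ha.le⟩ ⟨b, hb.le⟩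
  have := Function.invFun_eq hex
  by_contra hlt
  push Not at hlt
  have h2 := td_cdf_strictMono hlt
  unfold stdGaussianCDFInv at h2
  linarith

open scoped MatrixOrder in
lemma td_whiten {d : ℕ} (Sig : Matrix (Fin d) (Fin d) ℝ) (h : Sig.PosDef) :
    ∃ A : Matrix (Fin d) (Fin d) ℝ, Sig⁻¹ = Aᵀ * A ∧ A * Sig * Aᵀ = 1 ∧ IsUnit A.det := by
  have hi := h.inv
  obtain ⟨A, hA⟩ := CStarAlgebra.nonneg_iff_eq_star_mul_self.mp hi.posSemidef.nonneg
  have hA' : Sig⁻¹ = Aᵀ * A := by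
    rw [hA, star_eq_conjTranspose, conjTranspose_eq_transpose_of_trivial]
  have hu : IsUnit A.det := by
    have h2 := hi.det_pos
    rw [hA', det_mul, det_transpose] at h2
    exact isUnit_iff_ne_zero.mpr (fun h0 => by simp [h0] at h2)
  refine ⟨A, hA', ?_, hu⟩
  have hS : IsUnit Sig.det := isUnit_iff_ne_zero.mpr h.det_pos.ne'
  have hut : IsUnit Aᵀ.det := by rwa [det_transpose]
  have h3 : Aᵀ * A * Sig = 1 := by rw [← hA', nonsing_inv_mul _ hS]
  have h4 : A * Sig = (Aᵀ)⁻¹ := by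
    rw [Matrix.mul_assoc] at h3
    exact (Matrix.inv_eq_right_inv h3).symm
  rw [h4, nonsing_inv_mul _ hut]

lemma td_inner {d : ℕ} (A : Matrix (Fin d) (Fin d) ℝ) (w : TdE d) (y : Fin d → ℝ) :
    inner ℝ w (WithLp.toLp 2 (A *ᵥ y) : TdE d) = ∑ j, (Aᵀ *ᵥ w.ofLp) j * y j := by
  rw [EuclideanSpace.inner_eq_star_dotProduct]
  change (A *ᵥ y) ⬝ᵥ w.ofLp = (Aᵀ *ᵥ w.ofLp) ⬝ᵥ y
  rw [mulVec_transpose, ← dotProduct_mulVec, dotProduct_comm]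

lemma td_sqnorm {d : ℕ} (y : Fin d → ℝ) :
    ‖(WithLp.toLp 2 y : TdE d)‖ ^ 2 = y ⬝ᵥ y := by
  rw [EuclideanSpace.norm_sq_eq]
  simp [dotProduct, sq]

lemma td_law {d : ℕ} (A Sig : Matrix (Fin d) (Fin d) ℝ) (hA : A * Sig * Aᵀ = 1)
    (μ : Measure (Fin d → ℝ)) (βstar : Fin d → ℝ) (hG : IsMultivariateGaussian μ βstar Sig)
    (w : TdE d) :
    μ.map (fun x => inner ℝ w (WithLp.toLp 2 (A *ᵥ (x - βstar)) : TdE d))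
      = gaussianReal 0 (Real.toNNReal (‖w‖ ^ 2)) := by
  set v := Aᵀ *ᵥ w.ofLp with hv
  have h1 : (fun x : Fin d → ℝ => inner ℝ w (WithLp.toLp 2 (A *ᵥ (x - βstar)) : TdE d))
      = (fun t : ℝ => t - ∑ j, v j * βstar j) ∘ (fun x => ∑ j, v j * x j) := by
    funext x
    rw [td_inner]
    simp [mul_sub, Finset.sum_sub_distrib, hv]
  have h2 : v ⬝ᵥ (Sig *ᵥ v) = ‖w‖ ^ 2 := by
    have h5 : ‖w‖ ^ 2 = w.ofLp ⬝ᵥ w.ofLp := td_sqnorm w.ofLp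
    rw [h5, hv, mulVec_mulVec, mulVec_transpose, ← dotProduct_mulVec, mulVec_mulVec,
      ← Matrix.mul_assoc, hA, one_mulVec]
  rw [h1, ← Measure.map_map (by fun_prop) (by fun_prop), hG v, gaussianReal_map_sub_const, sub_self,
    h2]

lemma td_depth {d : ℕ} (m : ℕ) (B : Fin m → Fin d → ℝ) (y v : Fin d → ℝ) (hv : v ≠ 0) :
    (tukeyDepth (Multiset.map B Finset.univ.val) y : ℝ)
      ≤ ∑ i, tdStep (∑ j, v j * B i j - ∑ j, v j * y j) := by
  classical
  have h1 : tukeyDepth (Multiset.map B Finset.univ.val) y ≤ Multiset.countP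
      (fun x => ∑ j, v j * y j ≤ ∑ j, v j * x j) (Multiset.map B Finset.univ.val) :=
    Nat.sInf_le ⟨v, hv, by congr⟩
  have h2 : (Multiset.countP
      (fun x => ∑ j, v j * y j ≤ ∑ j, v j * x j) (Multiset.map B Finset.univ.val) : ℝ)
      = ∑ i, tdStep (∑ j, v j * B i j - ∑ j, v j * y j) := by
    rw [Multiset.countP_map]
    simp only [tdStep, sub_nonneg]
    rw [Finset.sum_boole]
    rfl
  rw [← h2]
  exact_mod_cast h1

lemma td_depth_zero (D : Multiset (Fin 0 → ℝ)) (y : Fin 0 → ℝ) : tukeyDepth D y = 0 := by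
  unfold tukeyDepth
  rw [Nat.sInf_eq_zero]
  right
  ext n
  simp only [Set.mem_ofPred_eq, Set.mem_empty_iff_false, iff_false]
  rintro ⟨v, hv, -⟩
  exact hv (Subsingleton.elim _ _)

lemma td_unit {d : ℕ} (hd : 1 ≤ d) (u : TdE d) : ∃ w : TdE d, ‖w‖ = 1 ∧ inner ℝ w u = ‖u‖ := by
  by_cases hu : u = 0
  · refine ⟨EuclideanSpace.single (⟨0, hd⟩ : Fin d) (1 : ℝ), by simp, by simp [hu]⟩
  · have hn : ‖u‖ ≠ 0 := norm_ne_zero_iff.mpr hu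
    refine ⟨‖u‖⁻¹ • u, by rw [norm_smul, norm_inv, norm_norm, inv_mul_cancel₀ hn], ?_⟩
    rw [real_inner_smul_left, real_inner_self_eq_norm_sq]
    field_simp

/-- There is a constant `c > 0` such that: for `0 < α, γ < 1`, a positive definite
`Σ ∈ ℝ^{d×d}`, a mean `β* ∈ ℝ^d`, and an i.i.d. sample `β_1, …, β_m` from `N(β*, Σ)` with
`m ≥ c (d + log(1/γ)) / α²`, with probability at least `1 − γ` over the sample, every point
`β̂` of Tukey depth at least `p` with respect to the sample (where `0 < 1 − p/m + α < 1`)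
satisfies `‖β̂ − β*‖_Σ ≤ Φ⁻¹(1 − p/m + α)`. -/
theorem tukeyDepth_gaussian_convergence :
    ∃ c : ℝ, 0 < c ∧
      ∀ (d : ℕ) (α γ : ℝ), 0 < α → α < 1 → 0 < γ → γ < 1 →
      ∀ (βstar : Fin d → ℝ) (Sig : Matrix (Fin d) (Fin d) ℝ), Sig.PosDef →
      ∀ (μ : Measure (Fin d → ℝ)) [IsProbabilityMeasure μ],
        IsMultivariateGaussian μ βstar Sig →
      ∀ m : ℕ, c * ((d : ℝ) + Real.log (1 / γ)) / α ^ 2 ≤ (m : ℝ) →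
        (Measure.pi fun _ : Fin m => μ)
          {B : Fin m → Fin d → ℝ |
            ∀ (βhat : Fin d → ℝ) (p : ℕ),
              0 < 1 - (p : ℝ) / (m : ℝ) + α → 1 - (p : ℝ) / (m : ℝ) + α < 1 →
              p ≤ tukeyDepth (Multiset.map B Finset.univ.val) βhat →
              mahalanobisNorm Sig (βhat - βstar)
                ≤ stdGaussianCDFInv (1 - (p : ℝ) / (m : ℝ) + α)}
          ≥ ENNReal.ofReal (1 - γ) := by
  refine ⟨30000, by norm_num, ?_⟩
  intro d α γ hα hα1 hγ hγ1 βstar Sig hSig μ _ hG m hm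
  rcases Nat.eq_zero_or_pos d with hd | hd
  · subst hd
    rw [ge_iff_le]
    refine le_trans ?_ (measure_mono (s := Set.univ) ?_)
    · rw [measure_univ]
      exact ENNReal.ofReal_le_one.mpr (by linarith)
    · intro B _ βhat p h0 h1 hp
      rw [td_depth_zero] at hp
      have : p = 0 := by omega
      subst this
      exfalso
      simp at h1
      linarith
  · obtain ⟨A, hA, hA1, hAu⟩ := td_whiten Sig hSig
    have hmain := td_main hd μ (fun x => (WithLp.toLp 2 (A *ᵥ (x - βstar)) : TdE d))
      (by fun_prop) (td_law A Sig hA1 μ βstar hG) α γ hα hα1 hγ hγ1 m hm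
    refine le_trans hmain (measure_mono ?_)
    intro B hB βhat p h0 h1 hp
    have hB' : ∀ w : TdE d, ‖w‖ = 1 → ∀ t : ℝ, 0 ≤ t →
      ∑ i, tdStep (inner ℝ w (WithLp.toLp 2 (A *ᵥ (B i - βstar)) : TdE d) - t)
        ≤ m * (1 - cdf (gaussianReal 0 1) t + α) := hB
    set u : TdE d := WithLp.toLp 2 (A *ᵥ (βhat - βstar)) with hu
    have hr : mahalanobisNorm Sig (βhat - βstar) = ‖u‖ := by
      unfold mahalanobisNorm
      have h8 : (βhat - βstar) ⬝ᵥ ((Aᵀ * A) *ᵥ (βhat - βstar)) = ‖u‖ ^ 2 := by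
        rw [hu, td_sqnorm, ← mulVec_mulVec, dotProduct_mulVec, vecMul_transpose]
      rw [hA, h8, Real.sqrt_sq (norm_nonneg _)]
    obtain ⟨w, hw, hwu⟩ := td_unit hd u
    have hv : Aᵀ *ᵥ w.ofLp ≠ 0 := by
      intro h
      have hut : IsUnit Aᵀ.det := by rwa [det_transpose]
      have h2 : w.ofLp = 0 := by
        have h3 := congrArg (fun z => (Aᵀ)⁻¹ *ᵥ z) h
        simpa [mulVec_mulVec, nonsing_inv_mul _ hut] using h3
      have h4 : w = 0 := by
        ext i
        simp [h2]
      rw [h4] at hw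
      simp at hw
    have hdep := td_depth m B βhat _ hv
    have heq : ∀ i, ∑ j, (Aᵀ *ᵥ w.ofLp) j * B i j - ∑ j, (Aᵀ *ᵥ w.ofLp) j * βhat j
        = inner ℝ w (WithLp.toLp 2 (A *ᵥ (B i - βstar)) : TdE d) - ‖u‖ := by
      intro i
      rw [← hwu, hu, td_inner, td_inner]
      simp only [Pi.sub_apply, mul_sub, Finset.sum_sub_distrib]
      ring
    simp only [heq] at hdep
    have h5 := hB' w hw ‖u‖ (norm_nonneg _)
    have hp' : (p : ℝ) ≤ tukeyDepth (Multiset.map B Finset.univ.val) βhat := by exact_mod_cast hp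
    have h6 : (p : ℝ) ≤ m * (1 - cdf (gaussianReal 0 1) ‖u‖ + α) := by linarith
    have hm0 : (0 : ℝ) < m := by
      rcases Nat.eq_zero_or_pos m with h | h
      · subst h
        simp at h1
        linarith
      · exact_mod_cast h
    rw [hr]
    apply td_inv _ _ h0 h1
    have h7 : (p : ℝ) / m ≤ 1 - cdf (gaussianReal 0 1) ‖u‖ + α := by
      rw [div_le_iff₀ hm0]
      linarith
    unfold stdGaussianCDF
    linarith
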